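/- arXiv:1708.02847 — 4 statements merged into one kernel-verified Lean document; each statement's English description precedes it below -/
import Mathlib

section
/- Let (g,[·,·,·]_g), (h,[·,·,·]_h) be 3-Lie algebras over a field K of characteristic 0, and let ρ, ν, ω be extension data with associated degree-1 cochain c ∈ C¹_>(g⊕h,h). Then (g⊕h, [·,·,·]_{(ρ,ν,ω)}) is a 3-Lie algebra if and only if δ̄c + (1/2)⟦c,c⟧ = 0, where for e_i = x_i + v_i ∈ g⊕h: (δ̄c)(e1∧e2, e3∧e4, e5) = c([e1,e2,e3]∧e4, e5) + c(e3∧[e1,e2,e4], e5) + c(e3∧e4, [e1,e2,e5]) − c(e1∧e2, [e3,e4,e5]) − [e1,e2,c(e3∧e4,e5)] + [e3,e4,c(e1∧e2,e5)] + [e4,e5,c(e1∧e2,e3)] + [e5,e3,c(e1∧e2,e4)] (with [·,·,·] the direct-sum bracket [x1+v1,x2+v2,x3+v3] = [x1,x2,x3]_g + [v1,v2,v3]_h), and (1/2)⟦c,c⟧(e1∧e2, e3∧e4, e5) = c(c(e1∧e2,e3)∧e4, e5) + c(e3∧c(e1∧e2,e4), e5) − c(e1∧e2, c(e3∧e4,e5))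 + c(e3∧e4, c(e1∧e2,e5)). -/
section

variable {K : Type*} [Field K]
variable {g h : Type*} [AddCommGroup g] [Module K g] [AddCommGroup h] [Module K h]

/-- The bracket `[·,·,·]_{(ρ,ν,ω)}` on `g ⊕ h` built from extension data. -/
def extBracket (bg : g →ₗ[K] g →ₗ[K] g →ₗ[K] g) (bh : h →ₗ[K] h →ₗ[K] h →ₗ[K] h)
    (ρ : g →ₗ[K] g →ₗ[K] Module.End K h)
    (ν : g →ₗ[K] h →ₗ[K] h →ₗ[K] h)
    (ω : g →ₗ[K] g →ₗ[K] g →ₗ[K] h) :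
    g × h → g × h → g × h → g × h :=
  fun a b c =>
    (bg a.1 b.1 c.1,
      ω a.1 b.1 c.1 + ρ a.1 b.1 c.2 + ρ b.1 c.1 a.2 + ρ c.1 a.1 b.2
        + ν a.1 b.2 c.2 + ν b.1 c.2 a.2 + ν c.1 a.2 b.2 + bh a.2 b.2 c.2)

/-- The direct-sum 3-Lie bracket on `g ⊕ h`. -/
def sumBracket (bg : g →ₗ[K] g →ₗ[K] g →ₗ[K] g) (bh : h →ₗ[K] h →ₗ[K] h →ₗ[K] h) :
    g × h → g × h → g × h → g × h :=
  fun a b c => (bg a.1 b.1 c.1, bh a.2 b.2 c.2)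

/-- The degree-1 cochain `c ∈ C¹_>(g⊕h, h)` associated to the extension data,
viewed with values embedded in `g ⊕ h`. -/
def extCochain (ρ : g →ₗ[K] g →ₗ[K] Module.End K h)
    (ν : g →ₗ[K] h →ₗ[K] h →ₗ[K] h)
    (ω : g →ₗ[K] g →ₗ[K] g →ₗ[K] h) :
    g × h → g × h → g × h → g × h :=
  fun a b c =>
    ((0 : g),
      ω a.1 b.1 c.1 + ρ a.1 b.1 c.2 + ρ b.1 c.1 a.2 + ρ c.1 a.1 b.2
        + ν a.1 b.2 c.2 + ν b.1 c.2 a.2 + ν c.1 a.2 b.2)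

end

section

variable {K : Type*} [Field K]
variable {g h V : Type*} [AddCommGroup g] [Module K g] [AddCommGroup h] [Module K h]
  [AddCommGroup V] [Module K V]
variable (bg : g →ₗ[K] g →ₗ[K] g →ₗ[K] g) (bh : h →ₗ[K] h →ₗ[K] h →ₗ[K] h)
  (ρ : g →ₗ[K] g →ₗ[K] Module.End K h) (ν : g →ₗ[K] h →ₗ[K] h →ₗ[K] h)
  (ω : g →ₗ[K] g →ₗ[K] g →ₗ[K] h)

theorem extBracket_eq_sumBracket_add_extCochain (a b c : g × h) :
    extBracket bg bh ρ ν ω a b c = sumBracket bg bh a b c + extCochain ρ ν ω a b c := by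
  ext
  · simp [extBracket, sumBracket, extCochain]
  · simp only [extBracket, sumBracket, extCochain, Prod.snd_add]
    abel

theorem sumBracket_add_left (a a' b c : g × h) :
    sumBracket bg bh (a + a') b c = sumBracket bg bh a b c + sumBracket bg bh a' b c := by
  simp [sumBracket]

theorem sumBracket_add_middle (a b b' c : g × h) :
    sumBracket bg bh a (b + b') c = sumBracket bg bh a b c + sumBracket bg bh a b' c := by
  simp [sumBracket]

theorem sumBracket_add_right (a b c c' : g × h) :
    sumBracket bg bh a b (c + c') = sumBracket bg bh a b c + sumBracket bg bh a b c' := by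
  simp [sumBracket]

theorem extCochain_add_left (a a' b c : g × h) :
    extCochain ρ ν ω (a + a') b c = extCochain ρ ν ω a b c + extCochain ρ ν ω a' b c := by
  ext
  · simp [extCochain]
  · simp only [extCochain, Prod.fst_add, Prod.snd_add, map_add, LinearMap.add_apply]
    abel

theorem extCochain_add_middle (a b b' c : g × h) :
    extCochain ρ ν ω a (b + b') c = extCochain ρ ν ω a b c + extCochain ρ ν ω a b' c := by
  ext
  · simp [extCochain]
  · simp only [extCochain, Prod.fst_add, Prod.snd_add, map_add, LinearMap.add_apply]
    abel

theorem extCochain_add_right (a b c c' : g × h) :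
    extCochain ρ ν ω a b (c + c') = extCochain ρ ν ω a b c + extCochain ρ ν ω a b c' := by
  ext
  · simp [extCochain]
  · simp only [extCochain, Prod.fst_add, Prod.snd_add, map_add, LinearMap.add_apply]
    abel

variable {bg bh ρ ν ω}

/-- An alternating trilinear map is invariant under cyclic permutations of its arguments. -/
theorem trilinear_rotate_of_alternating {f : V →ₗ[K] V →ₗ[K] V →ₗ[K] V}
    (hf : ∀ x y z : V, x = y ∨ y = z ∨ x = z → f x y z = 0) (x y z : V) :
    f x y z = f y z x := by
  have h₁ : f x y z + f y x z = 0 := by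
    simpa [hf] using hf (x + y) (x + y) z (Or.inl rfl)
  have h₂ : f y x z + f y z x = 0 := by
    simpa [hf] using hf y (x + z) (x + z) (Or.inr (Or.inl rfl))
  exact (eq_neg_of_add_eq_zero_left h₁).trans (eq_neg_of_add_eq_zero_right h₂).symm

theorem sumBracket_rotate
    (hgalt : ∀ x y z : g, x = y ∨ y = z ∨ x = z → bg x y z = 0)
    (hhalt : ∀ u v w : h, u = v ∨ v = w ∨ u = w → bh u v w = 0) (a b c : g × h) :
    sumBracket bg bh a b c = sumBracket bg bh b c a :=
  Prod.ext (trilinear_rotate_of_alternating hgalt _ _ _)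
    (trilinear_rotate_of_alternating hhalt _ _ _)

theorem sumBracket_fundamental_identity
    (hgfi : ∀ x1 x2 x3 x4 x5 : g,
      bg x1 x2 (bg x3 x4 x5)
        = bg (bg x1 x2 x3) x4 x5 + bg x3 (bg x1 x2 x4) x5 + bg x3 x4 (bg x1 x2 x5))
    (hhfi : ∀ v1 v2 v3 v4 v5 : h,
      bh v1 v2 (bh v3 v4 v5)
        = bh (bh v1 v2 v3) v4 v5 + bh v3 (bh v1 v2 v4) v5 + bh v3 v4 (bh v1 v2 v5))
    (a1 a2 a3 a4 a5 : g × h) :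
    sumBracket bg bh a1 a2 (sumBracket bg bh a3 a4 a5)
      = sumBracket bg bh (sumBracket bg bh a1 a2 a3) a4 a5
        + sumBracket bg bh a3 (sumBracket bg bh a1 a2 a4) a5
        + sumBracket bg bh a3 a4 (sumBracket bg bh a1 a2 a5) :=
  Prod.ext (hgfi _ _ _ _ _) (hhfi _ _ _ _ _)

theorem extBracket_alternating [CharZero K]
    (hgalt : ∀ x y z : g, x = y ∨ y = z ∨ x = z → bg x y z = 0)
    (hhalt : ∀ u v w : h, u = v ∨ v = w ∨ u = w → bh u v w = 0)
    (hρ : ∀ x y : g, ρ x y = - ρ y x)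
    (hν : ∀ (x : g) (u v : h), ν x u v = - ν x v u)
    (hω : ∀ x y z : g, x = y ∨ y = z ∨ x = z → ω x y z = 0)
    (a b c : g × h) (habc : a = b ∨ b = c ∨ a = c) :
    extBracket bg bh ρ ν ω a b c = 0 := by
  have : IsAddTorsionFree h := .of_isTorsionFree K h
  have hρ₀ (x : g) (v : h) : ρ x x v = 0 :=
    self_eq_neg.mp (LinearMap.congr_fun (hρ x x) v)
  have hν₀ (x : g) (v : h) : ν x v v = 0 := self_eq_neg.mp (hν x v v)
  have hρ' (x y : g) (v : h) : ρ x y v + ρ y x v = 0 := by rw [hρ x y]; simp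
  have hν' (x : g) (u v : h) : ν x u v + ν x v u = 0 := by rw [hν x u v]; simp
  have hg : bg a.1 b.1 c.1 = 0 := hgalt _ _ _ (by grind)
  have hh : bh a.2 b.2 c.2 = 0 := hhalt _ _ _ (by grind)
  have hω₀ : ω a.1 b.1 c.1 = 0 := hω _ _ _ (by grind)
  ext
  · exact hg
  · simp only [extBracket, hh, hω₀, Prod.snd_zero]
    rcases habc with rfl | rfl | rfl <;> grind

end

/-- `(g⊕h, [·,·,·]_{(ρ,ν,ω)})` is a 3-Lie algebra iff the associated
degree-1 cochain `c` satisfies the Maurer-Cartan equation `δ̄c + ½⟦c,c⟧ = 0`. -/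
theorem extBracket_threeLie_iff_maurerCartan {K : Type*} [Field K] [CharZero K]
    {g h : Type*} [AddCommGroup g] [Module K g] [AddCommGroup h] [Module K h]
    (bg : g →ₗ[K] g →ₗ[K] g →ₗ[K] g) (bh : h →ₗ[K] h →ₗ[K] h →ₗ[K] h)
    (hgalt : ∀ x y z : g, x = y ∨ y = z ∨ x = z → bg x y z = 0)
    (hgfi : ∀ x1 x2 x3 x4 x5 : g,
      bg x1 x2 (bg x3 x4 x5)
        = bg (bg x1 x2 x3) x4 x5 + bg x3 (bg x1 x2 x4) x5 + bg x3 x4 (bg x1 x2 x5))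
    (hhalt : ∀ u v w : h, u = v ∨ v = w ∨ u = w → bh u v w = 0)
    (hhfi : ∀ v1 v2 v3 v4 v5 : h,
      bh v1 v2 (bh v3 v4 v5)
        = bh (bh v1 v2 v3) v4 v5 + bh v3 (bh v1 v2 v4) v5 + bh v3 v4 (bh v1 v2 v5))
    (ρ : g →ₗ[K] g →ₗ[K] Module.End K h) (hρ : ∀ x y : g, ρ x y = - ρ y x)
    (ν : g →ₗ[K] h →ₗ[K] h →ₗ[K] h) (hν : ∀ (x : g) (u v : h), ν x u v = - ν x v u)
    (ω : g →ₗ[K] g →ₗ[K] g →ₗ[K] h)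
    (hω : ∀ x y z : g, x = y ∨ y = z ∨ x = z → ω x y z = 0) :
    ((∀ a b c : g × h, a = b ∨ b = c ∨ a = c → extBracket bg bh ρ ν ω a b c = 0) ∧
     (∀ a1 a2 a3 a4 a5 : g × h,
        extBracket bg bh ρ ν ω a1 a2 (extBracket bg bh ρ ν ω a3 a4 a5)
          = extBracket bg bh ρ ν ω (extBracket bg bh ρ ν ω a1 a2 a3) a4 a5
            + extBracket bg bh ρ ν ω a3 (extBracket bg bh ρ ν ω a1 a2 a4) a5
            + extBracket bg bh ρ ν ω a3 a4 (extBracket bg bh ρ ν ω a1 a2 a5)))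
    ↔ (∀ e1 e2 e3 e4 e5 : g × h,
        -- (δ̄ c)(e1∧e2, e3∧e4, e5)
        (extCochain ρ ν ω (sumBracket bg bh e1 e2 e3) e4 e5
          + extCochain ρ ν ω e3 (sumBracket bg bh e1 e2 e4) e5
          + extCochain ρ ν ω e3 e4 (sumBracket bg bh e1 e2 e5)
          - extCochain ρ ν ω e1 e2 (sumBracket bg bh e3 e4 e5)
          - sumBracket bg bh e1 e2 (extCochain ρ ν ω e3 e4 e5)
          + sumBracket bg bh e3 e4 (extCochain ρ ν ω e1 e2 e5)
          + sumBracket bg bh e4 e5 (extCochain ρ ν ω e1 e2 e3)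
          + sumBracket bg bh e5 e3 (extCochain ρ ν ω e1 e2 e4))
        -- + (½ ⟦c,c⟧)(e1∧e2, e3∧e4, e5)
        + (extCochain ρ ν ω (extCochain ρ ν ω e1 e2 e3) e4 e5
          + extCochain ρ ν ω e3 (extCochain ρ ν ω e1 e2 e4) e5
          - extCochain ρ ν ω e1 e2 (extCochain ρ ν ω e3 e4 e5)
          + extCochain ρ ν ω e3 e4 (extCochain ρ ν ω e1 e2 e5)) = 0) := by
  refine (and_iff_right (extBracket_alternating hgalt hhalt hρ hν hω)).trans
    (forall_congr' fun e1 => forall_congr' fun e2 => forall_congr' fun e3 =>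
      forall_congr' fun e4 => forall_congr' fun e5 => ?_)
  rw [eq_comm, ← sub_eq_zero]
  simp only [extBracket_eq_sumBracket_add_extCochain, sumBracket_add_left, sumBracket_add_middle,
    sumBracket_add_right, extCochain_add_left, extCochain_add_middle, extCochain_add_right]
  rw [sumBracket_fundamental_identity hgfi hhfi e1 e2 e3 e4 e5,
    sumBracket_rotate hgalt hhalt (extCochain ρ ν ω e1 e2 e3) e4 e5,
    ← sumBracket_rotate hgalt hhalt e5 e3 (extCochain ρ ν ω e1 e2 e4)]
  refine Eq.congr_left ?_
  abel
end

section
/- Let g and h be 3-Lie algebras over a field K of characteristic 0. The assignment (ρ,ν,ω) ↦ c is a bijection from the set of extension data triples (ρ,ν,ω) for which (g⊕h, [·,·,·]_{(ρ,ν,ω)}) is a 3-Lie algebra onto the set of Maurer–Cartan elements { c ∈ C¹_>(g⊕h,h) : δ̄c + (1/2)⟦c,c⟧ = 0 }. -/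
section

variable {K : Type*} [Field K]
variable {g h : Type*} [AddCommGroup g] [Module K g] [AddCommGroup h] [Module K h]

variable (K g h) in
/-- The type of extension data triples `(ρ, ν, ω)`. -/
abbrev ExtTriple :=
  (g →ₗ[K] g →ₗ[K] Module.End K h) × (g →ₗ[K] h →ₗ[K] h →ₗ[K] h)
    × (g →ₗ[K] g →ₗ[K] g →ₗ[K] h)

/-- `c ∈ C¹_>(g⊕h, h)`: an alternating trilinear `h`-valued map on `g ⊕ h`
vanishing when all of its arguments lie in `h`.  Here a cochain is represented by a raw
function and the (multi)linearity requirements are part of the predicate. -/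
def IsC1gt (K : Type*) [Field K] {g h : Type*}
    [AddCommGroup g] [Module K g] [AddCommGroup h] [Module K h]
    (c : g × h → g × h → g × h → h) : Prop :=
  (∀ a a' b d, c (a + a') b d = c a b d + c a' b d) ∧
  (∀ (t : K) a b d, c (t • a) b d = t • c a b d) ∧
  (∀ a b b' d, c a (b + b') d = c a b d + c a b' d) ∧
  (∀ (t : K) a b d, c a (t • b) d = t • c a b d) ∧
  (∀ a b d d', c a b (d + d') = c a b d + c a b d') ∧
  (∀ (t : K) a b d, c a b (t • d) = t • c a b d) ∧
  (∀ a b d : g × h, a = b ∨ b = d ∨ a = d → c a b d = 0) ∧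
  (∀ v1 v2 v3 : h, c ((0 : g), v1) ((0 : g), v2) ((0 : g), v3) = 0)

/-- The Maurer-Cartan equation `δ̄c + ½⟦c,c⟧ = 0` for a raw degree-1 cochain `c`. -/
def IsMaurerCartan (bg : g →ₗ[K] g →ₗ[K] g →ₗ[K] g) (bh : h →ₗ[K] h →ₗ[K] h →ₗ[K] h)
    (c : g × h → g × h → g × h → h) : Prop :=
  ∀ e1 e2 e3 e4 e5 : g × h,
    (((0 : g), c (sumBracket bg bh e1 e2 e3) e4 e5)
      + ((0 : g), c e3 (sumBracket bg bh e1 e2 e4) e5)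
      + ((0 : g), c e3 e4 (sumBracket bg bh e1 e2 e5))
      - ((0 : g), c e1 e2 (sumBracket bg bh e3 e4 e5))
      - sumBracket bg bh e1 e2 ((0 : g), c e3 e4 e5)
      + sumBracket bg bh e3 e4 ((0 : g), c e1 e2 e5)
      + sumBracket bg bh e4 e5 ((0 : g), c e1 e2 e3)
      + sumBracket bg bh e5 e3 ((0 : g), c e1 e2 e4))
    + (((0 : g), c ((0 : g), c e1 e2 e3) e4 e5)
      + ((0 : g), c e3 ((0 : g), c e1 e2 e4) e5)
      - ((0 : g), c e1 e2 ((0 : g), c e3 e4 e5))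
      + ((0 : g), c e3 e4 ((0 : g), c e1 e2 e5))) = 0

/-- The assignment `(ρ,ν,ω) ↦ c`. -/
def tripleToCochain (t : ExtTriple K g h) : g × h → g × h → g × h → h :=
  fun a b c =>
    t.2.2 a.1 b.1 c.1 + t.1 a.1 b.1 c.2 + t.1 b.1 c.1 a.2 + t.1 c.1 a.1 b.2
      + t.2.1 a.1 b.2 c.2 + t.2.1 b.1 c.2 a.2 + t.2.1 c.1 a.2 b.2

end

section

variable {K : Type*} [Field K]

/-- A trilinear map from a function that is linear in each argument. -/
def trilinearOfFun {A B C D : Type*} [AddCommGroup A] [Module K A] [AddCommGroup B] [Module K B]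
    [AddCommGroup C] [Module K C] [AddCommGroup D] [Module K D] (f : A → B → C → D)
    (add₁ : ∀ a a' b d, f (a + a') b d = f a b d + f a' b d)
    (smul₁ : ∀ (t : K) a b d, f (t • a) b d = t • f a b d)
    (add₂ : ∀ a b b' d, f a (b + b') d = f a b d + f a b' d)
    (smul₂ : ∀ (t : K) a b d, f a (t • b) d = t • f a b d)
    (add₃ : ∀ a b d d', f a b (d + d') = f a b d + f a b d')
    (smul₃ : ∀ (t : K) a b d, f a b (t • d) = t • f a b d) : A →ₗ[K] B →ₗ[K] C →ₗ[K] D :=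
  LinearMap.mk₂ K (fun a b => { toFun := f a b, map_add' := add₃ a b, map_smul' := (smul₃ · a b) })
    (fun a a' b => LinearMap.ext (add₁ a a' b)) (fun t a b => LinearMap.ext (smul₁ t a b))
    (fun a b b' => LinearMap.ext (add₂ a b b')) (fun t a b => LinearMap.ext (smul₂ t a b))

variable {g h : Type*} [AddCommGroup g] [Module K g] [AddCommGroup h] [Module K h]

theorem swap_of_alternating {A D : Type*} [AddCommGroup A] [AddCommGroup D] {f : A → A → A → D}
    (add₁ : ∀ a a' b d, f (a + a') b d = f a b d + f a' b d)
    (add₂ : ∀ a b b' d, f a (b + b') d = f a b d + f a b' d)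
    (add₃ : ∀ a b d d', f a b (d + d') = f a b d + f a b d')
    (alt : ∀ a b d, a = b ∨ b = d ∨ a = d → f a b d = 0) :
    (∀ a b d, f a b d = - f b a d) ∧ (∀ a b d, f a b d = - f a d b) := by
  refine ⟨fun a b d => ?_, fun a b d => ?_⟩
  · have := alt (a + b) (a + b) d (.inl rfl)
    rw [add₁, add₂, add₂, alt a a d (.inl rfl), alt b b d (.inl rfl), zero_add, add_zero] at this
    exact eq_neg_of_add_eq_zero_left this
  · have := alt a (b + d) (b + d) (.inr (.inl rfl))
    rw [add₂, add₃, add₃, alt a b b (.inr (.inl rfl)), alt a d d (.inr (.inl rfl)), zero_add,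
      add_zero] at this
    exact eq_neg_of_add_eq_zero_left this

theorem rotate_of_alternating {A : Type*} [AddCommGroup A] [Module K A]
    (b : A →ₗ[K] A →ₗ[K] A →ₗ[K] A) (alt : ∀ x y z : A, x = y ∨ y = z ∨ x = z → b x y z = 0)
    (x y z : A) : b x y z = b y z x := by
  obtain ⟨h₁, h₂⟩ := swap_of_alternating (f := fun x y z => b x y z)
    (by simp) (by simp) (by simp) alt
  have e₁ := h₁ x y z
  have e₂ := h₂ y x z
  rw [e₁, e₂, neg_neg]

theorem extBracket_eq (bg : g →ₗ[K] g →ₗ[K] g →ₗ[K] g) (bh : h →ₗ[K] h →ₗ[K] h →ₗ[K] h)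
    (t : ExtTriple K g h) (a b c : g × h) :
    extBracket bg bh t.1 t.2.1 t.2.2 a b c
      = sumBracket bg bh a b c + (0, tripleToCochain t a b c) := by
  ext
  · simp [extBracket, sumBracket]
  · simp only [extBracket, sumBracket, tripleToCochain, Prod.snd_add]
    abel

theorem tripleToCochain_injective :
    Function.Injective (tripleToCochain (K := K) (g := g) (h := h)) := by
  rintro ⟨ρ, ν, ω⟩ ⟨ρ', ν', ω'⟩ H
  have H' := fun a b c => congrFun (congrFun (congrFun H a) b) c
  refine Prod.ext ?_ (Prod.ext ?_ ?_)
  · ext x y v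
    simpa [tripleToCochain] using H' (x, 0) (y, 0) (0, v)
  · ext x u v
    simpa [tripleToCochain] using H' (x, 0) (0, u) (0, v)
  · ext x y z
    simpa [tripleToCochain] using H' (x, 0) (y, 0) (z, 0)

theorem extBracket_alternating_iff (bg : g →ₗ[K] g →ₗ[K] g →ₗ[K] g)
    (bh : h →ₗ[K] h →ₗ[K] h →ₗ[K] h)
    (hgalt : ∀ x y z : g, x = y ∨ y = z ∨ x = z → bg x y z = 0)
    (hhalt : ∀ u v w : h, u = v ∨ v = w ∨ u = w → bh u v w = 0) (t : ExtTriple K g h) :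
    (∀ a b c : g × h, a = b ∨ b = c ∨ a = c → extBracket bg bh t.1 t.2.1 t.2.2 a b c = 0) ↔
      ∀ a b c : g × h, a = b ∨ b = c ∨ a = c → tripleToCochain t a b c = 0 := by
  refine forall₄_congr fun a b c habc => ?_
  have hs : sumBracket bg bh a b c = 0 := by
    refine Prod.ext (hgalt _ _ _ ?_) (hhalt _ _ _ ?_) <;>
      rcases habc with rfl | rfl | rfl <;> simp
  rw [extBracket_eq, hs, zero_add, Prod.mk_eq_zero]
  simp

/-- The parts of the fundamental identity not involving the cochain hold by assumption; the
remaining ones make up the Maurer-Cartan equation. -/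
theorem extBracket_fundamental_iff (bg : g →ₗ[K] g →ₗ[K] g →ₗ[K] g)
    (bh : h →ₗ[K] h →ₗ[K] h →ₗ[K] h)
    (hgfi : ∀ x1 x2 x3 x4 x5 : g,
      bg x1 x2 (bg x3 x4 x5)
        = bg (bg x1 x2 x3) x4 x5 + bg x3 (bg x1 x2 x4) x5 + bg x3 x4 (bg x1 x2 x5))
    (hhalt : ∀ u v w : h, u = v ∨ v = w ∨ u = w → bh u v w = 0)
    (hhfi : ∀ v1 v2 v3 v4 v5 : h,
      bh v1 v2 (bh v3 v4 v5)
        = bh (bh v1 v2 v3) v4 v5 + bh v3 (bh v1 v2 v4) v5 + bh v3 v4 (bh v1 v2 v5))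
    (t : ExtTriple K g h) (hc : IsC1gt K (tripleToCochain t)) :
    (∀ a1 a2 a3 a4 a5 : g × h,
      extBracket bg bh t.1 t.2.1 t.2.2 a1 a2 (extBracket bg bh t.1 t.2.1 t.2.2 a3 a4 a5)
        = extBracket bg bh t.1 t.2.1 t.2.2
            (extBracket bg bh t.1 t.2.1 t.2.2 a1 a2 a3) a4 a5
          + extBracket bg bh t.1 t.2.1 t.2.2 a3
              (extBracket bg bh t.1 t.2.1 t.2.2 a1 a2 a4) a5
          + extBracket bg bh t.1 t.2.1 t.2.2 a3 a4
              (extBracket bg bh t.1 t.2.1 t.2.2 a1 a2 a5)) ↔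
      IsMaurerCartan bg bh (tripleToCochain t) := by
  obtain ⟨add₁, -, add₂, -, add₃, -⟩ := hc
  unfold IsMaurerCartan
  refine forall₅_congr fun e1 e2 e3 e4 e5 => ?_
  simp only [extBracket_eq]
  generalize tripleToCochain t = c at add₁ add₂ add₃
  simp only [add₁, add₂, add₃]
  rw [Prod.ext_iff, Prod.ext_iff]
  simp only [sumBracket, Prod.fst_add, Prod.snd_add, Prod.fst_sub, Prod.snd_sub, Prod.fst_zero,
    Prod.snd_zero, map_add, LinearMap.add_apply, map_zero, add_zero, sub_zero,
    hgfi e1.1, true_and]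
  rw [rotate_of_alternating bh hhalt (c e1 e2 e3),
    rotate_of_alternating bh hhalt e5.2 e3.2 (c e1 e2 e4), hhfi e1.2 e2.2 e3.2, ← sub_eq_zero, ← neg_eq_zero]
  refine Eq.congr ?_ rfl
  abel

theorem isC1gt_tripleToCochain {t : ExtTriple K g h}
    (alt : ∀ a b c : g × h, a = b ∨ b = c ∨ a = c → tripleToCochain t a b c = 0) :
    IsC1gt K (tripleToCochain t) := by
  refine ⟨?_, ?_, ?_, ?_, ?_, ?_, alt, ?_⟩
  · intros; simp [tripleToCochain]; abel
  · intros; simp [tripleToCochain, smul_add]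
  · intros; simp [tripleToCochain]; abel
  · intros; simp [tripleToCochain, smul_add]
  · intros; simp [tripleToCochain]; abel
  · intros; simp [tripleToCochain, smul_add]
  · intros; simp [tripleToCochain]

theorem exists_tripleToCochain_eq {c : g × h → g × h → g × h → h} (hc : IsC1gt K c) :
    ∃ t : ExtTriple K g h, tripleToCochain t = c ∧ (∀ x y : g, t.1 x y = - t.1 y x) ∧
      (∀ (x : g) (u v : h), t.2.1 x u v = - t.2.1 x v u) ∧
      (∀ x y z : g, x = y ∨ y = z ∨ x = z → t.2.2 x y z = 0) := by
  obtain ⟨add₁, smul₁, add₂, smul₂, add₃, smul₃, alt, van⟩ := hc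
  obtain ⟨swap₁, swap₂⟩ := swap_of_alternating add₁ add₂ add₃ alt
  have hadd_inl (x y : g) : (x + y, (0 : h)) = (x, 0) + (y, 0) := by simp
  have hadd_inr (x y : h) : ((0 : g), x + y) = (0, x) + (0, y) := by simp
  have hsmul_inl (s : K) (x : g) : (s • x, (0 : h)) = s • (x, 0) := by simp
  have hsmul_inr (s : K) (x : h) : ((0 : g), s • x) = s • (0, x) := by simp
  refine ⟨(trilinearOfFun (fun x y v => c (x, 0) (y, 0) (0, v)) ?_ ?_ ?_ ?_ ?_ ?_,
    trilinearOfFun (fun x u v => c (x, 0) (0, u) (0, v)) ?_ ?_ ?_ ?_ ?_ ?_,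
    trilinearOfFun (fun x y z => c (x, 0) (y, 0) (z, 0)) ?_ ?_ ?_ ?_ ?_ ?_),
    ?expand, ?skew_ρ, ?skew_ν, ?alt_ω⟩
  case expand =>
    funext ⟨x, u⟩ ⟨y, v⟩ ⟨z, w⟩
    have hsplit (x : g) (u : h) : (x, u) = (x, 0) + (0, u) := by simp
    change c (x, 0) (y, 0) (z, 0) + c (x, 0) (y, 0) (0, w) + c (y, 0) (z, 0) (0, u)
      + c (z, 0) (x, 0) (0, v) + c (x, 0) (0, v) (0, w) + c (y, 0) (0, w) (0, u)
      + c (z, 0) (0, u) (0, v) = _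
    rw [hsplit x u, hsplit y v, hsplit z w]
    simp only [add₁, add₂, add₃, van]
    rw [swap₁ (0, u) (y, 0) (z, 0), swap₂ (y, 0) (0, u) (z, 0),
      swap₂ (x, 0) (0, v) (z, 0), swap₁ (x, 0) (z, 0) (0, v),
      swap₁ (0, u) (y, 0) (0, w), swap₂ (y, 0) (0, u) (0, w),
      swap₂ (0, u) (0, v) (z, 0), swap₁ (0, u) (z, 0) (0, v)]
    abel
  case skew_ρ => exact fun x y => LinearMap.ext fun v => swap₁ (x, 0) (y, 0) (0, v)
  case skew_ν => exact fun x u v => swap₂ (x, 0) (0, u) (0, v)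
  case alt_ω =>
    intro x y z hxyz
    refine alt (x, 0) (y, 0) (z, 0) ?_
    simpa using hxyz
  all_goals
    intros
    simp only [hadd_inl, hadd_inr, hsmul_inl, hsmul_inr, add₁, add₂, add₃, smul₁, smul₂, smul₃]

end

/-- `(ρ,ν,ω) ↦ c` is a bijection from the set of extension data triples
for which `(g⊕h, [·,·,·]_{(ρ,ν,ω)})` is a 3-Lie algebra onto the set of
Maurer-Cartan elements of `C¹_>(g⊕h, h)`. -/
theorem tripleToCochain_bijOn_maurerCartan {K : Type*} [Field K] [CharZero K]
    {g h : Type*} [AddCommGroup g] [Module K g] [AddCommGroup h] [Module K h]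
    (bg : g →ₗ[K] g →ₗ[K] g →ₗ[K] g) (bh : h →ₗ[K] h →ₗ[K] h →ₗ[K] h)
    (hgalt : ∀ x y z : g, x = y ∨ y = z ∨ x = z → bg x y z = 0)
    (hgfi : ∀ x1 x2 x3 x4 x5 : g,
      bg x1 x2 (bg x3 x4 x5)
        = bg (bg x1 x2 x3) x4 x5 + bg x3 (bg x1 x2 x4) x5 + bg x3 x4 (bg x1 x2 x5))
    (hhalt : ∀ u v w : h, u = v ∨ v = w ∨ u = w → bh u v w = 0)
    (hhfi : ∀ v1 v2 v3 v4 v5 : h,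
      bh v1 v2 (bh v3 v4 v5)
        = bh (bh v1 v2 v3) v4 v5 + bh v3 (bh v1 v2 v4) v5 + bh v3 v4 (bh v1 v2 v5)) :
    Set.BijOn (tripleToCochain (K := K) (g := g) (h := h))
      {t : ExtTriple K g h |
        (∀ x y : g, t.1 x y = - t.1 y x) ∧
        (∀ (x : g) (u v : h), t.2.1 x u v = - t.2.1 x v u) ∧
        (∀ x y z : g, x = y ∨ y = z ∨ x = z → t.2.2 x y z = 0) ∧
        (∀ a b c : g × h, a = b ∨ b = c ∨ a = c →
          extBracket bg bh t.1 t.2.1 t.2.2 a b c = 0) ∧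
        (∀ a1 a2 a3 a4 a5 : g × h,
          extBracket bg bh t.1 t.2.1 t.2.2 a1 a2 (extBracket bg bh t.1 t.2.1 t.2.2 a3 a4 a5)
            = extBracket bg bh t.1 t.2.1 t.2.2
                (extBracket bg bh t.1 t.2.1 t.2.2 a1 a2 a3) a4 a5
              + extBracket bg bh t.1 t.2.1 t.2.2 a3
                  (extBracket bg bh t.1 t.2.1 t.2.2 a1 a2 a4) a5
              + extBracket bg bh t.1 t.2.1 t.2.2 a3 a4
                  (extBracket bg bh t.1 t.2.1 t.2.2 a1 a2 a5))}
      {c : g × h → g × h → g × h → h | IsC1gt K c ∧ IsMaurerCartan bg bh c} := by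
  refine ⟨?_, tripleToCochain_injective.injOn, ?_⟩
  · rintro t ⟨-, -, -, halt, hfi⟩
    have hc := isC1gt_tripleToCochain
      ((extBracket_alternating_iff bg bh hgalt hhalt t).1 halt)
    exact ⟨hc, (extBracket_fundamental_iff bg bh hgfi hhalt hhfi t hc).1 hfi⟩
  · rintro c ⟨hc, hmc⟩
    obtain ⟨t, rfl, hρ, hν, hω⟩ := exists_tripleToCochain_eq hc
    exact ⟨t, ⟨hρ, hν, hω,
      (extBracket_alternating_iff bg bh hgalt hhalt t).2 hc.2.2.2.2.2.2.1,
      (extBracket_fundamental_iff bg bh hgfi hhalt hhfi t hc).2 hmc⟩, rfl⟩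
end

section
/- Let g, h be 3-Lie algebras over a field K of characteristic 0, and let (ρ¹,ν¹,ω¹), (ρ²,ν²,ω²) be two extension data triples such that both (g⊕h,[·,·,·]_{(ρ¹,ν¹,ω¹)}) and (g⊕h,[·,·,·]_{(ρ²,ν²,ω²)}) are 3-Lie algebras, with associated Maurer–Cartan cochains c¹, c² ∈ C¹_>(g⊕h,h). Then the two extensions are isomorphic (there exists a 3-Lie morphism θ from [·,·,·]_{(ρ²,ν²,ω²)} to [·,·,·]_{(ρ¹,ν¹,ω¹)} with θ(v) = v for v ∈ h and pr_g∘θ = pr_g) if and only if c¹ and c² are gauge equivalent, i.e. there exists a linear map ξ: g → h (viewed as a degree-0 cochain, extended by 0 on h) such that c² = c¹ + ⟦ξ,c¹⟧ + (1/2)⟦ξ,⟦ξ,c¹⟧⟧ − δ̄ξ − (1/2)⟦ξ,δ̄ξ⟧ − (1/6)⟦ξ,⟦ξ,δ̄ξ⟧⟧. -/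
section

variable {K : Type*} [Field K]
variable {g h : Type*} [AddCommGroup g] [Module K g] [AddCommGroup h] [Module K h]

/-- A linear map `ξ : g → h` viewed as a degree-0 cochain on `g ⊕ h`, extended by `0` on `h`. -/
def deg0 (ξ : g →ₗ[K] h) : g × h → g × h := fun e => ((0 : g), ξ e.1)

/-- The bracket `⟦ξ,γ⟧` of a degree-0 cochain `ξ` with a degree-1 cochain `γ` on `g ⊕ h`. -/
def bracket01 (ξ : g × h → g × h) (γ : g × h → g × h → g × h → g × h) :
    g × h → g × h → g × h → g × h :=
  fun e1 e2 e3 => ξ (γ e1 e2 e3) - γ (ξ e1) e2 e3 - γ e1 (ξ e2) e3 - γ e1 e2 (ξ e3)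

/-- The differential `δ̄ξ` of a degree-0 cochain `ξ` with respect to the direct-sum
bracket on `g ⊕ h`. -/
def delta0 (bg : g →ₗ[K] g →ₗ[K] g →ₗ[K] g) (bh : h →ₗ[K] h →ₗ[K] h →ₗ[K] h)
    (ξ : g →ₗ[K] h) : g × h → g × h → g × h → g × h :=
  fun e1 e2 e3 =>
    sumBracket bg bh (deg0 ξ e1) e2 e3 + sumBracket bg bh e1 (deg0 ξ e2) e3
      + sumBracket bg bh e1 e2 (deg0 ξ e3) - deg0 ξ (sumBracket bg bh e1 e2 e3)

end

section

variable {K : Type*} [Field K]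
variable {g h : Type*} [AddCommGroup g] [Module K g] [AddCommGroup h] [Module K h]

/-- The gauge action of `ξ` on the cochain of an extension is conjugation of its bracket by
`(x, v) ↦ (x, v - ξ x)`. -/
theorem gauge_action_eq_conj [CharZero K] (bg : g →ₗ[K] g →ₗ[K] g →ₗ[K] g) (bh : h →ₗ[K] h →ₗ[K] h →ₗ[K] h)
    (ρ : g →ₗ[K] g →ₗ[K] Module.End K h) (ν : g →ₗ[K] h →ₗ[K] h →ₗ[K] h)
    (ω : g →ₗ[K] g →ₗ[K] g →ₗ[K] h) (ξ : g →ₗ[K] h) (e1 e2 e3 : g × h) :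
    extCochain ρ ν ω e1 e2 e3
        + bracket01 (deg0 ξ) (extCochain ρ ν ω) e1 e2 e3
        + ((1 : K) / 2) • bracket01 (deg0 ξ) (bracket01 (deg0 ξ) (extCochain ρ ν ω)) e1 e2 e3
        - delta0 bg bh ξ e1 e2 e3
        - ((1 : K) / 2) • bracket01 (deg0 ξ) (delta0 bg bh ξ) e1 e2 e3
        - ((1 : K) / 6) • bracket01 (deg0 ξ) (bracket01 (deg0 ξ) (delta0 bg bh ξ)) e1 e2 e3
      = extBracket bg bh ρ ν ω (e1.1, e1.2 - ξ e1.1) (e2.1, e2.2 - ξ e2.1) (e3.1, e3.2 - ξ e3.1)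
        + (0, ξ (bg e1.1 e2.1 e3.1)) - sumBracket bg bh e1 e2 e3 := by
  obtain ⟨x1, v1⟩ := e1
  obtain ⟨x2, v2⟩ := e2
  obtain ⟨x3, v3⟩ := e3
  refine Prod.ext ?_ ?_
  · simp [extCochain, bracket01, deg0, delta0, sumBracket, extBracket]
  · simp only [extCochain, bracket01, deg0, delta0, sumBracket, extBracket, Prod.fst_add,
      Prod.snd_add, Prod.fst_sub, Prod.snd_sub, Prod.smul_snd, map_sub, map_add,
      LinearMap.sub_apply, map_zero, LinearMap.zero_apply]
    module

/-- The extension bracket is the deformation of the direct-sum bracket by the cochain. -/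
theorem extBracket_eq_sumBracket_add (bg : g →ₗ[K] g →ₗ[K] g →ₗ[K] g)
    (bh : h →ₗ[K] h →ₗ[K] h →ₗ[K] h) (ρ : g →ₗ[K] g →ₗ[K] Module.End K h)
    (ν : g →ₗ[K] h →ₗ[K] h →ₗ[K] h) (ω : g →ₗ[K] g →ₗ[K] g →ₗ[K] h) (e1 e2 e3 : g × h) :
    extBracket bg bh ρ ν ω e1 e2 e3 = extCochain ρ ν ω e1 e2 e3 + sumBracket bg bh e1 e2 e3 :=
  Prod.ext (by simp [extBracket, extCochain, sumBracket]) rfl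

/-- Two extension cochains are related by the gauge action of `ξ` iff `(x, v) ↦ (x, v - ξ x)`
intertwines the brackets. -/
theorem gauge_iff_intertwines [CharZero K] (bg : g →ₗ[K] g →ₗ[K] g →ₗ[K] g)
    (bh : h →ₗ[K] h →ₗ[K] h →ₗ[K] h) (ρ1 ρ2 : g →ₗ[K] g →ₗ[K] Module.End K h)
    (ν1 ν2 : g →ₗ[K] h →ₗ[K] h →ₗ[K] h) (ω1 ω2 : g →ₗ[K] g →ₗ[K] g →ₗ[K] h)
    (ξ : g →ₗ[K] h) (e1 e2 e3 : g × h) :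
    extCochain ρ2 ν2 ω2 e1 e2 e3
        = extCochain ρ1 ν1 ω1 e1 e2 e3
          + bracket01 (deg0 ξ) (extCochain ρ1 ν1 ω1) e1 e2 e3
          + ((1 : K) / 2) • bracket01 (deg0 ξ)
              (bracket01 (deg0 ξ) (extCochain ρ1 ν1 ω1)) e1 e2 e3
          - delta0 bg bh ξ e1 e2 e3
          - ((1 : K) / 2) • bracket01 (deg0 ξ) (delta0 bg bh ξ) e1 e2 e3
          - ((1 : K) / 6) • bracket01 (deg0 ξ) (bracket01 (deg0 ξ) (delta0 bg bh ξ)) e1 e2 e3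
      ↔ extBracket bg bh ρ2 ν2 ω2 e1 e2 e3 - (0, ξ (extBracket bg bh ρ2 ν2 ω2 e1 e2 e3).1)
        = extBracket bg bh ρ1 ν1 ω1 (e1.1, e1.2 - ξ e1.1) (e2.1, e2.2 - ξ e2.1)
            (e3.1, e3.2 - ξ e3.1) := by
  rw [gauge_action_eq_conj, eq_sub_iff_add_eq, ← extBracket_eq_sumBracket_add, sub_eq_iff_eq_add]
  rfl

end

/-- two non-abelian extensions are isomorphic iff their Maurer-Cartan
cochains are gauge equivalent. -/
theorem extensions_isomorphic_iff_gauge_equivalent {K : Type*} [Field K] [CharZero K]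
    {g h : Type*} [AddCommGroup g] [Module K g] [AddCommGroup h] [Module K h]
    (bg : g →ₗ[K] g →ₗ[K] g →ₗ[K] g) (bh : h →ₗ[K] h →ₗ[K] h →ₗ[K] h)
    (hgalt : ∀ x y z : g, x = y ∨ y = z ∨ x = z → bg x y z = 0)
    (hgfi : ∀ x1 x2 x3 x4 x5 : g,
      bg x1 x2 (bg x3 x4 x5)
        = bg (bg x1 x2 x3) x4 x5 + bg x3 (bg x1 x2 x4) x5 + bg x3 x4 (bg x1 x2 x5))
    (hhalt : ∀ u v w : h, u = v ∨ v = w ∨ u = w → bh u v w = 0)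
    (hhfi : ∀ v1 v2 v3 v4 v5 : h,
      bh v1 v2 (bh v3 v4 v5)
        = bh (bh v1 v2 v3) v4 v5 + bh v3 (bh v1 v2 v4) v5 + bh v3 v4 (bh v1 v2 v5))
    (ρ1 ρ2 : g →ₗ[K] g →ₗ[K] Module.End K h)
    (hρ1 : ∀ x y : g, ρ1 x y = - ρ1 y x) (hρ2 : ∀ x y : g, ρ2 x y = - ρ2 y x)
    (ν1 ν2 : g →ₗ[K] h →ₗ[K] h →ₗ[K] h)
    (hν1 : ∀ (x : g) (u v : h), ν1 x u v = - ν1 x v u)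
    (hν2 : ∀ (x : g) (u v : h), ν2 x u v = - ν2 x v u)
    (ω1 ω2 : g →ₗ[K] g →ₗ[K] g →ₗ[K] h)
    (hω1 : ∀ x y z : g, x = y ∨ y = z ∨ x = z → ω1 x y z = 0)
    (hω2 : ∀ x y z : g, x = y ∨ y = z ∨ x = z → ω2 x y z = 0)
    (hfi1 : ∀ a1 a2 a3 a4 a5 : g × h,
      extBracket bg bh ρ1 ν1 ω1 a1 a2 (extBracket bg bh ρ1 ν1 ω1 a3 a4 a5)
        = extBracket bg bh ρ1 ν1 ω1 (extBracket bg bh ρ1 ν1 ω1 a1 a2 a3) a4 a5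
          + extBracket bg bh ρ1 ν1 ω1 a3 (extBracket bg bh ρ1 ν1 ω1 a1 a2 a4) a5
          + extBracket bg bh ρ1 ν1 ω1 a3 a4 (extBracket bg bh ρ1 ν1 ω1 a1 a2 a5))
    (hfi2 : ∀ a1 a2 a3 a4 a5 : g × h,
      extBracket bg bh ρ2 ν2 ω2 a1 a2 (extBracket bg bh ρ2 ν2 ω2 a3 a4 a5)
        = extBracket bg bh ρ2 ν2 ω2 (extBracket bg bh ρ2 ν2 ω2 a1 a2 a3) a4 a5
          + extBracket bg bh ρ2 ν2 ω2 a3 (extBracket bg bh ρ2 ν2 ω2 a1 a2 a4) a5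
          + extBracket bg bh ρ2 ν2 ω2 a3 a4 (extBracket bg bh ρ2 ν2 ω2 a1 a2 a5)) :
    (∃ θ : (g × h) →ₗ[K] (g × h),
        (∀ a b c : g × h,
          θ (extBracket bg bh ρ2 ν2 ω2 a b c)
            = extBracket bg bh ρ1 ν1 ω1 (θ a) (θ b) (θ c)) ∧
        (∀ v : h, θ (0, v) = (0, v)) ∧
        (∀ e : g × h, (θ e).1 = e.1))
    ↔ (∃ ξ : g →ₗ[K] h, ∀ e1 e2 e3 : g × h,
        extCochain ρ2 ν2 ω2 e1 e2 e3
          = extCochain ρ1 ν1 ω1 e1 e2 e3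
            + bracket01 (deg0 ξ) (extCochain ρ1 ν1 ω1) e1 e2 e3
            + ((1 : K) / 2) • bracket01 (deg0 ξ)
                (bracket01 (deg0 ξ) (extCochain ρ1 ν1 ω1)) e1 e2 e3
            - delta0 bg bh ξ e1 e2 e3
            - ((1 : K) / 2) • bracket01 (deg0 ξ) (delta0 bg bh ξ) e1 e2 e3
            - ((1 : K) / 6) • bracket01 (deg0 ξ)
                (bracket01 (deg0 ξ) (delta0 bg bh ξ)) e1 e2 e3) := by
  constructor
  · rintro ⟨θ, hθ, hθv, hθg⟩
    refine ⟨-(LinearMap.snd K g h ∘ₗ θ ∘ₗ LinearMap.inl K g h), fun e1 e2 e3 => ?_⟩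
    rw [gauge_iff_intertwines]
    have key (e : g × h) : θ e = (e.1, e.2 + (θ (e.1, 0)).2) := by
      refine Prod.ext (hθg e) ?_
      have hsplit : e = (0, e.2) + (e.1, 0) := by simp
      conv_lhs => rw [hsplit, map_add, hθv]
      rfl
    have hmor := hθ e1 e2 e3
    rw [key (extBracket bg bh ρ2 ν2 ω2 e1 e2 e3), key e1, key e2, key e3] at hmor
    simp only [LinearMap.neg_apply, LinearMap.comp_apply, LinearMap.snd_apply,
      LinearMap.inl_apply, sub_neg_eq_add]
    rw [← hmor]
    exact Prod.ext (by simp) (by simp)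
  · rintro ⟨ξ, hξ⟩
    refine ⟨LinearMap.id - LinearMap.inr K g h ∘ₗ ξ ∘ₗ LinearMap.fst K g h,
      fun a b c => ?_, fun v => by simp, fun e => by simp⟩
    have key (e : g × h) : (LinearMap.id - LinearMap.inr K g h ∘ₗ ξ ∘ₗ LinearMap.fst K g h :
        (g × h) →ₗ[K] (g × h)) e = (e.1, e.2 - ξ e.1) :=
      Prod.ext (by simp) (by simp)
    have hmor := (gauge_iff_intertwines bg bh ρ1 ρ2 ν1 ν2 ω1 ω2 ξ a b c).1 (hξ a b c)
    rw [key a, key b, key c, ← hmor]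
    rfl
end

section
/- Let g, h be 3-Lie algebras over a field K of characteristic 0 and let (ρ,ν,ω) be extension data such that (g⊕h, [·,·,·]_{(ρ,ν,ω)}) is a 3-Lie algebra. Define a bilinear operation {·,·} on (∧²h)⊕(g⊗h) by {u1∧v1 + x1⊗w1, u2∧v2 + x2⊗w2} = [u1,v1,u2]_h∧v2 + u2∧[u1,v1,v2]_h + ν(x2)(u1,v1)∧w2 + x2⊗[u1,v1,w2]_h + ν(x1)(w1,u2)∧v2 + u2∧ν(x1)(w1,v2) − ρ(x1,x2)(w1)∧w2 + x2⊗ν(x1)(w1,w2) (u_i,v_i,w_i ∈ h, x_i ∈ g). Then ((∧²h)⊕(g⊗h), {·,·}) is a Leibniz algebra. -/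
open scoped TensorProduct

/-- The simple wedge `x ∧ y` in the second exterior power `⋀[K]^2 g`. -/
noncomputable def wedge2 (K : Type*) [Field K] {g : Type*} [AddCommGroup g] [Module K g]
    (x y : g) : ⋀[K]^2 g :=
  ⟨ExteriorAlgebra.ιMulti K 2 ![x, y], ExteriorAlgebra.ιMulti_range K 2 (Set.mem_range_self _)⟩

section WedgeProduct

variable {K : Type*} [Field K] {h : Type*} [AddCommGroup h] [Module K h]

theorem coe_wedge2 (x y : h) :
    (wedge2 K x y : ExteriorAlgebra K h) = ExteriorAlgebra.ι K x * ExteriorAlgebra.ι K y := by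
  simp [wedge2, ExteriorAlgebra.ιMulti_apply]

theorem wedge2_add_left (x y z : h) : wedge2 K (x + y) z = wedge2 K x z + wedge2 K y z := by
  apply Subtype.ext
  simp [coe_wedge2, add_mul]

theorem wedge2_add_right (x y z : h) : wedge2 K x (y + z) = wedge2 K x y + wedge2 K x z := by
  apply Subtype.ext
  simp [coe_wedge2, mul_add]

theorem wedge2_smul_left (r : K) (x y : h) : wedge2 K (r • x) y = r • wedge2 K x y := by
  apply Subtype.ext
  simp [coe_wedge2]

theorem wedge2_zero_left (y : h) : wedge2 K (0 : h) y = 0 := by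
  apply Subtype.ext
  simp [coe_wedge2]

theorem wedge2_neg_left (x y : h) : wedge2 K (-x) y = -wedge2 K x y := by
  apply Subtype.ext
  simp [coe_wedge2]

theorem wedge2_induction {p : ⋀[K]^2 h → Prop} (hwedge : ∀ x y, p (wedge2 K x y))
    (hadd : ∀ a b, p a → p b → p (a + b)) (a : ⋀[K]^2 h) : p a := by
  have ha : a ∈ Submodule.span K (Set.range (exteriorPower.ιMulti K 2 (M := h))) := by
    rw [exteriorPower.ιMulti_span]
    trivial
  induction ha using Submodule.closure_induction with
  | zero => simpa [wedge2_zero_left] using hwedge 0 0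
  | add a b _ _ ha hb => exact hadd a b ha hb
  | smul_mem r a ha =>
    obtain ⟨v, rfl⟩ := ha
    have hv : r • exteriorPower.ιMulti K 2 v = wedge2 K (r • v 0) (v 1) := by
      rw [wedge2_smul_left]
      congr 1
    rw [hv]
    exact hwedge _ _

end WedgeProduct

section FundamentalKernel

variable {K : Type*} [Field K]
variable {g h : Type*} [AddCommGroup g] [Module K g] [AddCommGroup h] [Module K h]

/-- The image of `a ∧ w`, for `a ∈ g ⊕ h` and `w ∈ h`, under the identification of
`(g ⊕ h) ∧ h` with `(⋀²h) ⊕ (g ⊗ h)`. -/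
noncomputable def kernelWedge (K : Type*) [Field K] {g h : Type*} [AddCommGroup g] [Module K g]
    [AddCommGroup h] [Module K h] (a : g × h) (w : h) : ⋀[K]^2 h × (g ⊗[K] h) :=
  (wedge2 K a.2 w, a.1 ⊗ₜ[K] w)

theorem kernelWedge_add_left (a b : g × h) (w : h) :
    kernelWedge K (a + b) w = kernelWedge K a w + kernelWedge K b w := by
  simp [kernelWedge, wedge2_add_left, TensorProduct.add_tmul]

theorem kernelWedge_add_right (a : g × h) (v w : h) :
    kernelWedge K a (v + w) = kernelWedge K a v + kernelWedge K a w := by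
  simp [kernelWedge, wedge2_add_right, TensorProduct.tmul_add]

theorem kernelWedge_induction {p : ⋀[K]^2 h × (g ⊗[K] h) → Prop}
    (hwedge : ∀ a w, p (kernelWedge K a w)) (hadd : ∀ a b, p a → p b → p (a + b))
    (a : ⋀[K]^2 h × (g ⊗[K] h)) : p a := by
  have hleft : ∀ s : ⋀[K]^2 h, p (s, 0) := by
    apply wedge2_induction
    · intro x y
      simpa [kernelWedge] using hwedge (0, x) y
    · intro s t hs ht
      simpa using hadd _ _ hs ht
  have hright : ∀ t : g ⊗[K] h, p (0, t) := by
    intro t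
    induction t using TensorProduct.induction_on with
    | zero => exact hleft 0
    | tmul x w => simpa [kernelWedge, wedge2_zero_left] using hwedge (x, 0) w
    | add s t hs ht => simpa using hadd _ _ hs ht
  simpa using hadd _ _ (hleft a.1) (hright a.2)

theorem extBracket_mem_right (bg : g →ₗ[K] g →ₗ[K] g →ₗ[K] g)
    (bh : h →ₗ[K] h →ₗ[K] h →ₗ[K] h) (ρ : g →ₗ[K] g →ₗ[K] Module.End K h)
    (ν : g →ₗ[K] h →ₗ[K] h →ₗ[K] h) (ω : g →ₗ[K] g →ₗ[K] g →ₗ[K] h) (a c : g × h) (w : h) :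
    ((0 : g), (extBracket bg bh ρ ν ω a (0, w) c).2) = extBracket bg bh ρ ν ω a (0, w) c := by
  simp [extBracket]

/-- The Leibniz rule for an operation on `(⋀²h) ⊕ (g ⊗ h)` induced by a bracket `e` on `g ⊕ h`
that satisfies the fundamental identity and for which `h` is an ideal. -/
theorem leibniz_of_kernelWedge (e : g × h → g × h → g × h → g × h)
    (hideal : ∀ a c w, ((0 : g), (e a (0, w) c).2) = e a (0, w) c)
    (hfi : ∀ a b c d f, e a b (e c d f) = e (e a b c) d f + e c (e a b d) f + e c d (e a b f))
    (B : (⋀[K]^2 h × (g ⊗[K] h)) →ₗ[K] (⋀[K]^2 h × (g ⊗[K] h)) →ₗ[K]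
          (⋀[K]^2 h × (g ⊗[K] h)))
    (hB : ∀ a b c d, B (kernelWedge K a b) (kernelWedge K c d)
      = kernelWedge K (e a (0, b) c) d + kernelWedge K c (e a (0, b) (0, d)).2)
    (a b c : ⋀[K]^2 h × (g ⊗[K] h)) : B a (B b c) = B (B a b) c + B b (B a c) := by
  induction a using kernelWedge_induction with
  | hadd a a' ha ha' =>
    simp only [map_add, LinearMap.add_apply, ha, ha']
    abel
  | hwedge a u =>
  induction b using kernelWedge_induction with
  | hadd b b' hb hb' =>
    simp only [map_add, LinearMap.add_apply, hb, hb']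
    abel
  | hwedge b v =>
  induction c using kernelWedge_induction with
  | hadd c c' hc hc' =>
    simp only [map_add, hc, hc']
    abel
  | hwedge c w =>
    simp only [hB, map_add, LinearMap.add_apply, hideal]
    rw [hfi a (0, u) b (0, v) c, hfi a (0, u) b (0, v) (0, w)]
    simp only [Prod.snd_add, kernelWedge_add_left, kernelWedge_add_right]
    abel

end FundamentalKernel

/-- the bracket `{·,·}` on `(⋀²h) ⊕ (g ⊗ h)` determined on generators by
the formula built from `[·,·,·]_h`, `ν` and `ρ` is a Leibniz bracket. -/
theorem fundamentalKernel_leibniz {K : Type*} [Field K] [CharZero K]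
    {g h : Type*} [AddCommGroup g] [Module K g] [AddCommGroup h] [Module K h]
    (bg : g →ₗ[K] g →ₗ[K] g →ₗ[K] g) (bh : h →ₗ[K] h →ₗ[K] h →ₗ[K] h)
    (hgalt : ∀ x y z : g, x = y ∨ y = z ∨ x = z → bg x y z = 0)
    (hgfi : ∀ x1 x2 x3 x4 x5 : g,
      bg x1 x2 (bg x3 x4 x5)
        = bg (bg x1 x2 x3) x4 x5 + bg x3 (bg x1 x2 x4) x5 + bg x3 x4 (bg x1 x2 x5))
    (hhalt : ∀ u v w : h, u = v ∨ v = w ∨ u = w → bh u v w = 0)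
    (hhfi : ∀ v1 v2 v3 v4 v5 : h,
      bh v1 v2 (bh v3 v4 v5)
        = bh (bh v1 v2 v3) v4 v5 + bh v3 (bh v1 v2 v4) v5 + bh v3 v4 (bh v1 v2 v5))
    (ρ : g →ₗ[K] g →ₗ[K] Module.End K h) (hρ : ∀ x y : g, ρ x y = - ρ y x)
    (ν : g →ₗ[K] h →ₗ[K] h →ₗ[K] h) (hν : ∀ (x : g) (u v : h), ν x u v = - ν x v u)
    (ω : g →ₗ[K] g →ₗ[K] g →ₗ[K] h)
    (hω : ∀ x y z : g, x = y ∨ y = z ∨ x = z → ω x y z = 0)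
    -- the extension bracket defines a 3-Lie algebra structure on g ⊕ h:
    (healt : ∀ a b c : g × h, a = b ∨ b = c ∨ a = c → extBracket bg bh ρ ν ω a b c = 0)
    (hefi : ∀ a1 a2 a3 a4 a5 : g × h,
      extBracket bg bh ρ ν ω a1 a2 (extBracket bg bh ρ ν ω a3 a4 a5)
        = extBracket bg bh ρ ν ω (extBracket bg bh ρ ν ω a1 a2 a3) a4 a5
          + extBracket bg bh ρ ν ω a3 (extBracket bg bh ρ ν ω a1 a2 a4) a5
          + extBracket bg bh ρ ν ω a3 a4 (extBracket bg bh ρ ν ω a1 a2 a5))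
    (B : (⋀[K]^2 h × (g ⊗[K] h)) →ₗ[K] (⋀[K]^2 h × (g ⊗[K] h)) →ₗ[K]
          (⋀[K]^2 h × (g ⊗[K] h)))
    (hB : ∀ (u1 v1 u2 v2 w1 w2 : h) (x1 x2 : g),
      B (wedge2 K u1 v1, x1 ⊗ₜ[K] w1) (wedge2 K u2 v2, x2 ⊗ₜ[K] w2)
        = (wedge2 K (bh u1 v1 u2) v2 + wedge2 K u2 (bh u1 v1 v2)
            + wedge2 K (ν x2 u1 v1) w2 + wedge2 K (ν x1 w1 u2) v2
            + wedge2 K u2 (ν x1 w1 v2) - wedge2 K (ρ x1 x2 w1) w2,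
           x2 ⊗ₜ[K] (bh u1 v1 w2) + x2 ⊗ₜ[K] (ν x1 w1 w2))) :
    ∀ a b c : ⋀[K]^2 h × (g ⊗[K] h),
      B a (B b c) = B (B a b) c + B b (B a c) := by
  refine leibniz_of_kernelWedge (extBracket bg bh ρ ν ω) (extBracket_mem_right bg bh ρ ν ω)
    hefi B ?_
  intro a u c w
  have hρu : ρ c.1 a.1 u = -ρ a.1 c.1 u := by
    rw [hρ, LinearMap.neg_apply]
  simp only [kernelWedge, hB, extBracket, map_zero, LinearMap.zero_apply, add_zero, zero_add,
    wedge2_add_left, wedge2_add_right, hρu, wedge2_neg_left, Prod.mk_add_mk,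
    TensorProduct.zero_tmul, TensorProduct.tmul_add]
  refine Prod.ext ?_ ?_ <;> dsimp only <;> abel
end
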